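/- Let R : Fin n → Fin n → Prop be elementary and irreducible with G_R connected and m edges. If n = 2 then m = 4, and if n = 3 then m ≥ 7. -/

import Mathlib

/-- The permutation matrix of `σ`: entry 1 at `(i, σ i)` and 0 elsewhere. -/
def permMat {n : ℕ} (σ : Equiv.Perm (Fin n)) : Matrix (Fin n) (Fin n) ℝ :=
  fun i j => if σ i = j then 1 else 0

/-- `σ` is a (perfect) matching of the bipartite graph of `R`. -/
def IsMatching {n : ℕ} (R : Fin n → Fin n → Prop) (σ : Equiv.Perm (Fin n)) : Prop :=
  ∀ i, R i (σ i)

/-- `R` is elementary (a face graph): every edge lies in some matching. -/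
def IsElementary {n : ℕ} (R : Fin n → Fin n → Prop) : Prop :=
  ∀ i j, R i j → ∃ σ : Equiv.Perm (Fin n), IsMatching R σ ∧ σ i = j

/-- The face of the Birkhoff polytope corresponding to `R`. -/
def face {n : ℕ} (R : Fin n → Fin n → Prop) : Set (Matrix (Fin n) (Fin n) ℝ) :=
  convexHull ℝ {M | ∃ σ : Equiv.Perm (Fin n), IsMatching R σ ∧ M = permMat σ}

/-- The bipartite simple graph `G_R` on `Fin n ⊕ Fin n`, where `Sum.inl i` and
`Sum.inr j` are adjacent iff `R i j`. -/
def graphOf {n : ℕ} (R : Fin n → Fin n → Prop) : SimpleGraph (Fin n ⊕ Fin n) :=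
  SimpleGraph.fromRel (fun a b => ∃ i j, a = Sum.inl i ∧ b = Sum.inr j ∧ R i j)

/-- The degree of the upper node `i`. -/
def upDeg {n : ℕ} (R : Fin n → Fin n → Prop) [∀ i j, Decidable (R i j)] (i : Fin n) : ℕ :=
  Fintype.card {j // R i j}

/-- The degree of the lower node `j`. -/
def loDeg {n : ℕ} (R : Fin n → Fin n → Prop) [∀ i j, Decidable (R i j)] (j : Fin n) : ℕ :=
  Fintype.card {i // R i j}

/-- The number of edges of the bipartite graph of `R`. -/
def edgeCount {n : ℕ} (R : Fin n → Fin n → Prop) [∀ i j, Decidable (R i j)] : ℕ :=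
  Fintype.card {p : Fin n × Fin n // R p.1 p.2}

/-- An upper node `v` of degree 2 with neighbors `w₁ ≠ w₂` is reducible if no `u ≠ v`
is adjacent to both `w₁` and `w₂`. -/
def UpperReducible {n : ℕ} (R : Fin n → Fin n → Prop) (v : Fin n) : Prop :=
  ∃ w₁ w₂ : Fin n, w₁ ≠ w₂ ∧ R v w₁ ∧ R v w₂ ∧ (∀ j, R v j → j = w₁ ∨ j = w₂) ∧
    ¬ ∃ u, u ≠ v ∧ R u w₁ ∧ R u w₂

/-- Reducibility of lower nodes, defined symmetrically. -/
def LowerReducible {n : ℕ} (R : Fin n → Fin n → Prop) (v : Fin n) : Prop :=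
  UpperReducible (fun i j => R j i) v

/-- `R` is irreducible if none of its nodes is reducible. -/
def IrreducibleRel {n : ℕ} (R : Fin n → Fin n → Prop) : Prop :=
  (∀ v, ¬ UpperReducible R v) ∧ (∀ v, ¬ LowerReducible R v)

/-- The face poset of a set `P`: the collection of its faces (convex extreme subsets),
ordered by inclusion. -/
def facesOf {E : Type*} [AddCommGroup E] [Module ℝ E] (P : Set E) : Set (Set E) :=
  {F | Convex ℝ F ∧ IsExtreme ℝ P F}

/-- In a connected bipartite graph, a nonempty set of upper nodes together with a set of lower
nodes that no edge leaves contains every upper node. -/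
theorem mem_of_connected {n : ℕ} {R : Fin n → Fin n → Prop} (hconn : (graphOf R).Connected)
    {S T : Set (Fin n)} (hST : ∀ i j, R i j → (i ∈ S ↔ j ∈ T)) (hS : S.Nonempty) (i : Fin n) :
    i ∈ S := by
  obtain ⟨i₀, hi₀⟩ := hS
  have step : ∀ a b, (graphOf R).Adj a b →
      (Sum.elim (· ∈ S) (· ∈ T) a ↔ Sum.elim (· ∈ S) (· ∈ T) b) := by
    rintro a b hab
    rw [graphOf, SimpleGraph.fromRel_adj] at hab
    obtain ⟨-, ⟨i, j, rfl, rfl, h⟩ | ⟨i, j, rfl, rfl, h⟩⟩ := hab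
    · simpa using hST i j h
    · simpa using (hST i j h).symm
  have walk : ∀ a b, (graphOf R).Walk a b →
      (Sum.elim (· ∈ S) (· ∈ T) a ↔ Sum.elim (· ∈ S) (· ∈ T) b) := by
    intro a b p
    induction p with
    | nil => exact Iff.rfl
    | cons h _ ih => exact (step _ _ h).trans ih
  obtain ⟨p⟩ := hconn.preconnected (Sum.inl i₀) (Sum.inl i)
  exact (walk _ _ p).1 hi₀

theorem graphOf_swap_connected {n : ℕ} {R : Fin n → Fin n → Prop}
    (hconn : (graphOf R).Connected) : (graphOf fun i j => R j i).Connected := by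
  let e : graphOf R ≃g graphOf fun i j => R j i :=
    { toEquiv := Equiv.sumComm _ _
      map_rel_iff' := by
        rintro (a | a) (b | b) <;> simp [graphOf] }
  exact e.connected_iff.1 hconn

theorem IsElementary.swap {n : ℕ} {R : Fin n → Fin n → Prop} (hel : IsElementary R) :
    IsElementary fun i j => R j i := by
  intro j i hij
  obtain ⟨σ, hσ, rfl⟩ := hel i j hij
  exact ⟨σ.symm, fun k => by simpa using hσ (σ.symm k), by simp⟩

theorem edgeCount_eq_sum_upDeg {n : ℕ} (R : Fin n → Fin n → Prop) [∀ i j, Decidable (R i j)] :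
    edgeCount R = ∑ i, upDeg R i := by
  simp only [edgeCount, upDeg]
  rw [← Fintype.card_sigma]
  exact Fintype.card_congr (Equiv.subtypeProdEquivSigmaSubtype R)

theorem edgeCount_swap {n : ℕ} (R : Fin n → Fin n → Prop) [∀ i j, Decidable (R i j)] :
    edgeCount (fun i j => R j i) = edgeCount R :=
  Fintype.card_congr ((Equiv.prodComm _ _).subtypeEquiv fun _ => Iff.rfl)

theorem two_le_upDeg {n : ℕ} {R : Fin n → Fin n → Prop} [∀ i j, Decidable (R i j)]
    (hn : 2 ≤ n) (hel : IsElementary R) (hconn : (graphOf R).Connected) (i : Fin n) :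
    2 ≤ upDeg R i := by
  have : Nontrivial (Fin n) := Fin.nontrivial_iff_two_le.2 hn
  obtain ⟨k, hk⟩ := exists_ne i
  by_contra! hlt
  have hsub : ∀ j j', R i j → R i j' → j = j' := fun j j' h h' => congrArg Subtype.val <|
    Fintype.card_le_one_iff.1 (Nat.le_of_lt_succ hlt) ⟨j, h⟩ ⟨j', h'⟩
  refine hk (mem_of_connected hconn (S := {i}) (T := {j | R i j}) (fun i' j h => ?_)
    (Set.singleton_nonempty i) k)
  constructor
  · rintro rfl
    exact h
  · intro hj
    obtain ⟨σ, hσ, rfl⟩ := hel i' j h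
    exact σ.injective (hsub _ _ hj (hσ i))

theorem upDeg_eq_two_of_edgeCount_le {n : ℕ} {R : Fin n → Fin n → Prop}
    [∀ i j, Decidable (R i j)] (hn : 2 ≤ n) (hel : IsElementary R)
    (hconn : (graphOf R).Connected) (hm : edgeCount R ≤ 2 * n) (i : Fin n) : upDeg R i = 2 := by
  have hle : ∀ k ∈ Finset.univ, 2 ≤ upDeg R k := fun k _ => two_le_upDeg hn hel hconn k
  refine ((Finset.sum_eq_sum_iff_of_le hle).1 (le_antisymm (Finset.sum_le_sum hle) ?_)
    i (Finset.mem_univ i)).symm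
  rw [← edgeCount_eq_sum_upDeg]
  simpa [mul_comm] using hm

/-- A node of degree two has no neighbours besides two given distinct ones. -/
theorem eq_or_eq_of_upDeg_eq_two {n : ℕ} {R : Fin n → Fin n → Prop} [∀ i j, Decidable (R i j)]
    {i a b j : Fin n} (hdeg : upDeg R i = 2) (hab : a ≠ b) (ha : R i a) (hb : R i b)
    (hj : R i j) : j = a ∨ j = b := by
  by_contra! h
  have hcard : ({a, b, j} : Finset (Fin n)).card = 3 :=
    Finset.card_eq_three.2 ⟨a, b, j, hab, h.1.symm, h.2.symm, rfl⟩
  have hle : ({a, b, j} : Finset (Fin n)).card ≤ (Finset.univ.filter (R i)).card :=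
    Finset.card_le_card fun x hx => by
      simp only [Finset.mem_insert, Finset.mem_singleton] at hx
      obtain rfl | rfl | rfl := hx <;> simpa
  rw [upDeg, Fintype.card_subtype] at hdeg
  exact absurd (hcard.symm.trans_le (hle.trans_eq hdeg)) (by decide)

/-- A connected irreducible face graph with more than two nodes in each layer is not a cycle. -/
theorem two_mul_lt_edgeCount {n : ℕ} {R : Fin n → Fin n → Prop} [∀ i j, Decidable (R i j)]
    (hn : 3 ≤ n) (hel : IsElementary R) (hirr : IrreducibleRel R)
    (hconn : (graphOf R).Connected) : 2 * n < edgeCount R := by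
  by_contra! hm
  have hup : ∀ i, upDeg R i = 2 := upDeg_eq_two_of_edgeCount_le (by omega) hel hconn hm
  have hlo : ∀ j, upDeg (fun i j => R j i) j = 2 :=
    upDeg_eq_two_of_edgeCount_le (by omega) hel.swap (graphOf_swap_connected hconn)
      ((edgeCount_swap R).trans_le hm)
  let v : Fin n := ⟨0, by omega⟩
  obtain ⟨⟨a, ha⟩, ⟨b, hb⟩, hne⟩ :=
    Fintype.one_lt_card_iff.1 (one_lt_two.trans_eq (hup v).symm)
  have hab : a ≠ b := fun h => hne (Subtype.ext h)
  have hu : ∃ u, u ≠ v ∧ R u a ∧ R u b := by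
    by_contra h
    exact hirr.1 v ⟨a, b, hab, ha, hb,
      fun j hj => eq_or_eq_of_upDeg_eq_two (hup v) hab ha hb hj, h⟩
  obtain ⟨u, huv, hua, hub⟩ := hu
  have hall : ∀ i, i ∈ ({u, v} : Set (Fin n)) := by
    refine mem_of_connected hconn (T := {a, b}) (fun i j h => ?_) ⟨u, by simp⟩
    simp only [Set.mem_insert_iff, Set.mem_singleton_iff]
    constructor
    · rintro (rfl | rfl)
      · exact eq_or_eq_of_upDeg_eq_two (hup _) hab hua hub h
      · exact eq_or_eq_of_upDeg_eq_two (hup _) hab ha hb h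
    · rintro (rfl | rfl)
      · exact eq_or_eq_of_upDeg_eq_two (R := fun i j => R j i) (hlo _) huv hua ha h
      · exact eq_or_eq_of_upDeg_eq_two (R := fun i j => R j i) (hlo _) huv hub hb h
  have hcard : n ≤ ({u, v} : Finset (Fin n)).card := by
    rw [Finset.eq_univ_of_forall (s := {u, v}) (by simpa using hall), Finset.card_fin]
  have := Finset.card_le_two (a := u) (b := v)
  omega

/-- An irreducible connected face graph with two nodes in each layer has four edges;
with three nodes in each layer it has at least seven edges. -/
theorem stmt10 (n : ℕ) (R : Fin n → Fin n → Prop) [∀ i j, Decidable (R i j)]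
    (hel : IsElementary R) (hirr : IrreducibleRel R) (hconn : (graphOf R).Connected) :
    (n = 2 → edgeCount R = 4) ∧ (n = 3 → 7 ≤ edgeCount R) := by
  constructor
  · rintro rfl
    have hle : edgeCount R ≤ 4 := by
      simpa [edgeCount] using Fintype.card_subtype_le fun p : Fin 2 × Fin 2 => R p.1 p.2
    have h0 := two_le_upDeg le_rfl hel hconn 0
    have h1 := two_le_upDeg le_rfl hel hconn 1
    have hsum := edgeCount_eq_sum_upDeg R
    rw [Fin.sum_univ_two] at hsum
    omega
  · rintro rfl
    exact two_mul_lt_edgeCount le_rfl hel hirr hconn
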